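/- arXiv:2507.10362 — 2 statements merged into one kernel-verified Lean document; each statement's English description precedes it below -/
import Mathlib

section
/- Let S be a distribution over pure states such that {|ζ_{x,z}⟩⟨ζ_{x,z}|⊗k moments} form a relative ε-approximate state 2-design, i.e. E_{ζ←S}[|ζ⟩⟨ζ|^{⊗2}] lies between (1−ε) and (1+ε) times ∫|φ⟩⟨φ|^{⊗2}dμ in the PSD order. Then for any positive semidefinite Hermitian O and density matrix ρ: |E[Tr(O ρ̂)] − Tr(Oρ)| ≤ ε(Tr(ρ)Tr(O) + Tr(Oρ)) ≤ 2ε·Tr(O), where ρ̂ is the state-based classical shadow. -/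
open Matrix Kronecker ComplexOrder

/-- Computational basis index for `n` qubits. -/
abbrev QVec (n : ℕ) := Fin n → Fin 2

/-- Tensor product of Pauli `X` operators: `X^x`. -/
noncomputable def pauliX {n : ℕ} (x : QVec n) : Matrix (QVec n) (QVec n) ℂ :=
  fun a b => if a = b + x then 1 else 0

/-- Tensor product of Pauli `Z` operators: `Z^z`. -/
noncomputable def pauliZ {n : ℕ} (z : QVec n) : Matrix (QVec n) (QVec n) ℂ :=
  fun a b => if a = b then (-1 : ℂ) ^ (∑ i, (z i).val * (a i).val) else 0

/-- Outer product `|v⟩⟨v|`. -/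
noncomputable def outer {n : ℕ} (v : QVec n → ℂ) : Matrix (QVec n) (QVec n) ℂ :=
  vecMulVec v (star v)

/-- The Pauli-shifted, entrywise-conjugated state `|ζ*_{x,z}⟩` where `|ζ_{x,z}⟩ = X^x Z^z |ζ⟩`. -/
noncomputable def shiftConj {n : ℕ} (ζ : QVec n → ℂ) (x z : QVec n) : QVec n → ℂ :=
  star ((pauliX x * pauliZ z).mulVec ζ)

/-- The swap operator on two `n`-qubit registers. -/
noncomputable def swapQ (n : ℕ) : Matrix (QVec n × QVec n) (QVec n × QVec n) ℂ :=
  fun p q => if p.1 = q.2 ∧ p.2 = q.1 then 1 else 0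

/-- The second Haar moment `∫|φ⟩⟨φ|^{⊗2} dμ = (I + SWAP)/(2^n(2^n+1))`. -/
noncomputable def haar2Q (n : ℕ) : Matrix (QVec n × QVec n) (QVec n × QVec n) ℂ :=
  (((2 ^ n : ℂ)) * ((2 ^ n : ℂ) + 1))⁻¹ • (1 + swapQ n)

/-- The operator permuting the three registers of `((ℂ^{2^n})^{⊗3}` according to `π`. -/
noncomputable def permOp3Q (n : ℕ) (π : Equiv.Perm (Fin 3)) :
    Matrix (Fin 3 → QVec n) (Fin 3 → QVec n) ℂ :=
  fun a b => if a = b ∘ π then 1 else 0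

/-- The third Haar moment `Π_{sym³}/dim(sym³)` on three `n`-qubit registers. -/
noncomputable def haar3Q (n : ℕ) : Matrix (Fin 3 → QVec n) (Fin 3 → QVec n) ℂ :=
  (((2 ^ n : ℂ) * ((2 ^ n : ℂ) + 1) * ((2 ^ n : ℂ) + 2) / 6))⁻¹ •
    (((6 : ℂ))⁻¹ • ∑ π : Equiv.Perm (Fin 3), permOp3Q n π)

/-- Threefold tensor power of a vector. -/
noncomputable def tpow3 {n : ℕ} (v : QVec n → ℂ) : (Fin 3 → QVec n) → ℂ :=
  fun f => ∏ j, v (f j)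

/-- Outer product of the threefold tensor power: `|v⟩⟨v|^{⊗3}`. -/
noncomputable def outer3 {n : ℕ} (v : QVec n → ℂ) :
    Matrix (Fin 3 → QVec n) (Fin 3 → QVec n) ℂ :=
  vecMulVec (tpow3 v) (star (tpow3 v))

/-- Threefold Kronecker product on three `n`-qubit registers. -/
noncomputable def kron3Q {n : ℕ} (A B C : Matrix (QVec n) (QVec n) ℂ) :
    Matrix (Fin 3 → QVec n) (Fin 3 → QVec n) ℂ :=
  fun a b => A (a 0) (b 0) * B (a 1) (b 1) * C (a 2) (b 2)

namespace Matrix.PosSemidef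

/-- The trace of the product of two positive semidefinite matrices is nonnegative. -/
lemma trace_mul_nonneg {m : Type*} [Fintype m] [DecidableEq m] {A B : Matrix m m ℂ}
    (hA : A.PosSemidef) (hB : B.PosSemidef) : 0 ≤ (A * B).trace := by
  obtain ⟨C, rfl⟩ : ∃ C, B = Cᴴ * C := by
    open scoped MatrixOrder in
    exact CStarAlgebra.nonneg_iff_eq_star_mul_self.mp hB.nonneg
  rw [← mul_assoc, trace_mul_comm, ← mul_assoc]
  exact (hA.mul_mul_conjTranspose_same C).trace_nonneg

end Matrix.PosSemidef

section Pauli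

variable {n : ℕ}

lemma pauliX_mul_conjTranspose (x : QVec n) : pauliX x * (pauliX x)ᴴ = 1 := by
  ext a b
  have h (j : QVec n) : a = j + x ↔ a - x = j := by rw [sub_eq_iff_eq_add]
  simp only [pauliX, mul_apply, conjTranspose_apply, apply_ite star, star_one, star_zero,
    mul_ite, mul_one, mul_zero, one_apply, h]
  simp [Finset.sum_ite, eq_comm]

lemma pauliZ_mul_conjTranspose (z : QVec n) : pauliZ z * (pauliZ z)ᴴ = 1 := by
  ext a b
  by_cases hab : a = b
  · subst hab
    simp [pauliZ, mul_apply, ← mul_pow]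
  · simp [pauliZ, mul_apply, one_apply, hab, Ne.symm hab]

lemma pauliX_mul_pauliZ_mul_conjTranspose (x z : QVec n) :
    (pauliX x * pauliZ z) * (pauliX x * pauliZ z)ᴴ = 1 := by
  rw [conjTranspose_mul, mul_assoc, ← mul_assoc (pauliZ z), pauliZ_mul_conjTranspose, one_mul,
    pauliX_mul_conjTranspose]

lemma outer_star_mulVec (U : Matrix (QVec n) (QVec n) ℂ) (v : QVec n → ℂ) :
    outer (star (U *ᵥ v)) = (U * outer v * Uᴴ)ᵀ := by
  rw [outer, outer, mul_vecMulVec, vecMulVec_mul, transpose_vecMulVec, star_star, ← star_mulVec]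

end Pauli

section Swap

variable {n : ℕ}

lemma swapQ_mul_apply (A : Matrix (QVec n × QVec n) (QVec n × QVec n) ℂ)
    (p q : QVec n × QVec n) : (swapQ n * A) p q = A p.swap q := by
  have h (j : QVec n × QVec n) : (p.1 = j.2 ∧ p.2 = j.1) ↔ p.swap = j := by
    simp [Prod.ext_iff, and_comm]
  simp [swapQ, mul_apply, h]

lemma swapQ_mul_swapQ : swapQ n * swapQ n = 1 := by
  ext p q
  rw [swapQ_mul_apply]
  simp [swapQ, one_apply, Prod.ext_iff, and_comm]

lemma swapQ_conjTranspose : (swapQ n)ᴴ = swapQ n := by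
  ext p q
  simp [swapQ, apply_ite, and_comm, eq_comm]

lemma one_sub_swapQ_posSemidef : (1 - swapQ n).PosSemidef := by
  have h : (1 - swapQ n) = (2⁻¹ : ℝ) • ((1 - swapQ n)ᴴ * (1 - swapQ n)) := by
    rw [conjTranspose_sub, conjTranspose_one, swapQ_conjTranspose, sub_mul, one_mul, mul_sub,
      mul_one, swapQ_mul_swapQ, show (1 - swapQ n - (swapQ n - 1)) = (2 : ℝ) • (1 - swapQ n) by
        rw [two_smul]; abel, smul_smul]
    norm_num
  rw [h]
  exact (posSemidef_conjTranspose_mul_self _).smul (by norm_num)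

lemma trace_swapQ_mul_kronecker (A B : Matrix (QVec n) (QVec n) ℂ) :
    (swapQ n * (A ⊗ₖ B)).trace = (A * B).trace := by
  simp only [trace, diag_apply, swapQ_mul_apply]
  simp only [kroneckerMap_apply, mul_apply, Fintype.sum_prod_type, Prod.fst_swap, Prod.snd_swap]
  exact Finset.sum_comm

lemma trace_haar2Q_mul_kronecker (A B : Matrix (QVec n) (QVec n) ℂ) :
    (haar2Q n * (A ⊗ₖ B)).trace =
      (((2 ^ n : ℝ) * ((2 ^ n : ℝ) + 1))⁻¹ : ℝ) * (A.trace * B.trace + (A * B).trace) := by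
  rw [haar2Q, smul_mul_assoc, trace_smul, add_mul, one_mul, trace_add, trace_kronecker,
    trace_swapQ_mul_kronecker, smul_eq_mul]
  push_cast
  rfl

lemma re_trace_mul_le {A B : Matrix (QVec n) (QVec n) ℂ} (hA : A.PosSemidef)
    (hB : B.PosSemidef) : (A * B).trace.re ≤ (A.trace * B.trace).re := by
  have h := one_sub_swapQ_posSemidef.trace_mul_nonneg (hA.kronecker hB)
  rw [sub_mul, one_mul, trace_sub, trace_kronecker, trace_swapQ_mul_kronecker] at h
  simpa using (Complex.le_def.mp h).1

end Swap

section ApproximateDesign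

variable {n : ℕ} {ε : ℝ} {T : Matrix (QVec n × QVec n) (QVec n × QVec n) ℂ}
  {A B : Matrix (QVec n) (QVec n) ℂ}

lemma le_re_trace_mul_kronecker (hT : (T - (1 - ε) • haar2Q n).PosSemidef)
    (hA : A.PosSemidef) (hB : B.PosSemidef) :
    (1 - ε) * (((2 ^ n : ℝ) * ((2 ^ n : ℝ) + 1))⁻¹ *
      (A.trace * B.trace + (A * B).trace).re) ≤ (T * (A ⊗ₖ B)).trace.re := by
  have h := hT.trace_mul_nonneg (hA.kronecker hB)
  rw [sub_mul, smul_mul_assoc, trace_sub, trace_smul, trace_haar2Q_mul_kronecker] at h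
  have h' := (Complex.le_def.mp h).1
  rwa [Complex.sub_re, Complex.smul_re, Complex.re_ofReal_mul, Complex.zero_re, sub_nonneg] at h'

lemma re_trace_mul_kronecker_le (hT : ((1 + ε) • haar2Q n - T).PosSemidef)
    (hA : A.PosSemidef) (hB : B.PosSemidef) :
    (T * (A ⊗ₖ B)).trace.re ≤ (1 + ε) * (((2 ^ n : ℝ) * ((2 ^ n : ℝ) + 1))⁻¹ *
      (A.trace * B.trace + (A * B).trace).re) := by
  have h := hT.trace_mul_nonneg (hA.kronecker hB)
  rw [sub_mul, smul_mul_assoc, trace_sub, trace_smul, trace_haar2Q_mul_kronecker] at h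
  have h' := (Complex.le_def.mp h).1
  rwa [Complex.sub_re, Complex.smul_re, Complex.re_ofReal_mul, Complex.zero_re, sub_nonneg] at h'

end ApproximateDesign

section Conjugation

variable {m : Type*} [Fintype m]

lemma trace_transpose_conj_mul (U Z R : Matrix m m ℂ) :
    ((U * Z * Uᴴ)ᵀ * R).trace = (Z * (Uᴴ * Rᵀ * U)).trace := by
  rw [← trace_transpose, transpose_mul, transpose_transpose, trace_mul_comm, mul_assoc,
    mul_assoc, trace_mul_comm]
  simp only [mul_assoc]

lemma trace_conj_transpose [DecidableEq m] {U : Matrix m m ℂ} (hU : U * Uᴴ = 1) (R : Matrix m m ℂ) :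
    (Uᴴ * Rᵀ * U).trace = R.trace := by
  rw [trace_mul_comm, ← mul_assoc, hU, one_mul, trace_transpose]

lemma trace_conj_transpose_mul [DecidableEq m] {U : Matrix m m ℂ} (hU : U * Uᴴ = 1)
    (R S : Matrix m m ℂ) :
    ((Uᴴ * Rᵀ * U) * (Uᴴ * Sᵀ * U)).trace = (S * R).trace := by
  have h : (Uᴴ * Rᵀ * U) * (Uᴴ * Sᵀ * U) = Uᴴ * (S * R)ᵀ * U := by
    rw [transpose_mul]
    simp only [mul_assoc]
    rw [← mul_assoc U, hU, one_mul]
  rw [h, trace_conj_transpose hU]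

end Conjugation

/-- The trace of a Pauli-shifted, conjugated second moment against `ρ ⊗ O` is the trace of the
original second moment against the correspondingly rotated operators. -/
lemma trace_shiftConj_moment_mul {n : ℕ} {ι : Type*} [Fintype ι] (w : ι → ℝ)
    (ζ : ι → QVec n → ℂ) (ρ O : Matrix (QVec n) (QVec n) ℂ) :
    ((∑ i, w i • ∑ x : QVec n, ∑ z : QVec n,
      outer (shiftConj (ζ i) x z) ⊗ₖ outer (shiftConj (ζ i) x z)) * (ρ ⊗ₖ O)).trace =
    ∑ x : QVec n, ∑ z : QVec n, ((∑ i, w i • (outer (ζ i) ⊗ₖ outer (ζ i))) *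
      (((pauliX x * pauliZ z)ᴴ * ρᵀ * (pauliX x * pauliZ z)) ⊗ₖ
        ((pauliX x * pauliZ z)ᴴ * Oᵀ * (pauliX x * pauliZ z)))).trace := by
  simp only [Finset.sum_mul, smul_mul_assoc, trace_sum, trace_smul, shiftConj, outer_star_mulVec,
    ← mul_kronecker_mul, trace_kronecker, trace_transpose_conj_mul, Finset.smul_sum]
  rw [Finset.sum_comm]
  exact Finset.sum_congr rfl fun x _ => Finset.sum_comm

/-- Bias bound for a relative `ε`-approximate state 2-design: for positive `O`,
`|E[Tr(Oρ̂)] − Tr(Oρ)| ≤ ε(Tr(ρ)Tr(O) + Tr(Oρ)) ≤ 2ε·Tr(O)`. -/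
theorem stmt7 (n : ℕ) (ε : ℝ) (hε : 0 ≤ ε) {ι : Type} [Fintype ι]
    (w : ι → ℝ) (hw : ∀ i, 0 ≤ w i) (hw1 : ∑ i, w i = 1)
    (ζ : ι → QVec n → ℂ) (hζ : ∀ i, star (ζ i) ⬝ᵥ ζ i = 1)
    (hrel₁ : ((∑ i, w i • (outer (ζ i) ⊗ₖ outer (ζ i))) - (1 - ε) • haar2Q n).PosSemidef)
    (hrel₂ : ((1 + ε) • haar2Q n - ∑ i, w i • (outer (ζ i) ⊗ₖ outer (ζ i))).PosSemidef)
    (ρ O : Matrix (QVec n) (QVec n) ℂ)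
    (hρ : ρ.PosSemidef) (hρtr : ρ.trace = 1) (hO : O.PosSemidef)
    (M : Matrix (QVec n × QVec n) (QVec n × QVec n) ℂ)
    (hM : M = ∑ i, w i • ∑ x : QVec n, ∑ z : QVec n,
      outer (shiftConj (ζ i) x z) ⊗ₖ outer (shiftConj (ζ i) x z))
    (Eest : ℝ)
    (hE : Eest = ((((2 ^ n : ℂ) + 1) / (2 ^ n : ℂ)) * (M * (ρ ⊗ₖ O)).trace - O.trace).re) :
    |Eest - ((O * ρ).trace).re| ≤
        ε * ((ρ.trace).re * (O.trace).re + ((O * ρ).trace).re) ∧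
      ε * ((ρ.trace).re * (O.trace).re + ((O * ρ).trace).re) ≤ 2 * ε * (O.trace).re := by
  have hO0 : (O * ρ).trace.re ≤ O.trace.re := by
    simpa [hρtr] using re_trace_mul_le hO hρ
  refine ⟨?_, ?_⟩
  swap
  · rw [hρtr, Complex.one_re, one_mul]
    nlinarith
  set s : ℝ := O.trace.re + (O * ρ).trace.re with hs
  set d : ℝ := 2 ^ n with hd
  have hd0 : 0 < d := by positivity
  set t : ℝ := (M * (ρ ⊗ₖ O)).trace.re with ht
  have hMt := trace_shiftConj_moment_mul w ζ ρ O
  rw [← hM] at hMt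
  have hEt : Eest = (d + 1) / d * t - O.trace.re := by
    rw [hE, Complex.sub_re, ht, ← Complex.re_ofReal_mul]
    simp [hd]
  have key (x z : QVec n) := pauliX_mul_pauliZ_mul_conjTranspose x z
  have hs' (x z : QVec n) :
      (((pauliX x * pauliZ z)ᴴ * ρᵀ * (pauliX x * pauliZ z)).trace *
        ((pauliX x * pauliZ z)ᴴ * Oᵀ * (pauliX x * pauliZ z)).trace +
        (((pauliX x * pauliZ z)ᴴ * ρᵀ * (pauliX x * pauliZ z)) *
        ((pauliX x * pauliZ z)ᴴ * Oᵀ * (pauliX x * pauliZ z))).trace).re = s := by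
    rw [trace_conj_transpose (key x z), trace_conj_transpose (key x z),
      trace_conj_transpose_mul (key x z), hρtr, one_mul, Complex.add_re]
  have hconst (c : ℝ) : ∑ _x : QVec n, ∑ _z : QVec n, c = d * d * c := by
    simp [hd, mul_assoc]
  have hlow : d * d * ((1 - ε) * ((d * (d + 1))⁻¹ * s)) ≤ t := by
    rw [ht, hMt, Complex.re_sum, ← hconst]
    refine Finset.sum_le_sum fun x _ => ?_
    rw [Complex.re_sum]
    refine Finset.sum_le_sum fun z _ => ?_
    rw [← hs' x z]
    exact le_re_trace_mul_kronecker hrel₁ (hρ.transpose.conjTranspose_mul_mul_same _)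
      (hO.transpose.conjTranspose_mul_mul_same _)
  have hupp : t ≤ d * d * ((1 + ε) * ((d * (d + 1))⁻¹ * s)) := by
    rw [ht, hMt, Complex.re_sum, ← hconst]
    refine Finset.sum_le_sum fun x _ => ?_
    rw [Complex.re_sum]
    refine Finset.sum_le_sum fun z _ => ?_
    rw [← hs' x z]
    exact re_trace_mul_kronecker_le hrel₂ (hρ.transpose.conjTranspose_mul_mul_same _)
      (hO.transpose.conjTranspose_mul_mul_same _)
  have hc : 0 ≤ (d + 1) / d := by positivity
  have hcancel (a : ℝ) : (d + 1) / d * (d * d * (a * ((d * (d + 1))⁻¹ * s))) = a * s := by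
    field_simp
  have h1 := mul_le_mul_of_nonneg_left hlow hc
  have h2 := mul_le_mul_of_nonneg_left hupp hc
  rw [hcancel] at h1 h2
  rw [hρtr, Complex.one_re, one_mul, ← hs, abs_le, hEt]
  constructor <;> linarith
end

section
/- Variance bound for relative approximate designs: if S is a relative ε-approximate state 3-design over n ≥ 2 qubits, O is a positive semidefinite Hermitian observable, and ρ̂ is the state-based classical shadow of a density matrix ρ, then Var[Tr(O ρ̂)] ≤ 3·Tr(O₀²) + 10ε·Tr(O)², where O₀ = O − (Tr(O)/2^n)I. -/
open Matrix Kronecker ComplexOrder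

namespace ShadowVariance

open Finset

section General

variable {α : Type*} [Fintype α]

open scoped MatrixOrder Matrix.Norms.L2Operator in
theorem exists_eq_conjTranspose_mul_self {P : Matrix α α ℂ} (hP : P.PosSemidef) :
    ∃ X : Matrix α α ℂ, P = Xᴴ * X := by
  classical
  exact CStarAlgebra.nonneg_iff_eq_star_mul_self.mp hP.nonneg

/-- The trace of a product of positive semidefinite matrices is nonnegative and at most the
product of the traces. -/
theorem trace_mul_bounds {P Q : Matrix α α ℂ} (hP : P.PosSemidef) (hQ : Q.PosSemidef) :
    0 ≤ (P * Q).trace.re ∧ (P * Q).trace.re ≤ P.trace.re * Q.trace.re := by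
  classical
  let _ := Matrix.frobeniusNormedAddCommGroup (m := α) (n := α) (α := ℂ)
  have key : ∀ M : Matrix α α ℂ, (Mᴴ * M).trace.re = ‖M‖ ^ 2 := by
    intro M
    rw [Matrix.frobenius_norm_def, ← Real.sqrt_eq_rpow,
      Real.sq_sqrt (Finset.sum_nonneg fun i _ => Finset.sum_nonneg fun j _ => by positivity)]
    simp only [Matrix.trace, Matrix.diag_apply, Matrix.mul_apply, Matrix.conjTranspose_apply,
      Complex.re_sum]
    rw [Finset.sum_comm]
    refine Finset.sum_congr rfl fun i _ => Finset.sum_congr rfl fun j _ => ?_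
    rw [Complex.star_def, ← Complex.normSq_eq_conj_mul_self, Complex.ofReal_re,
      Complex.normSq_eq_norm_sq]
    norm_cast
  obtain ⟨X, rfl⟩ := exists_eq_conjTranspose_mul_self hP
  obtain ⟨Y, rfl⟩ := exists_eq_conjTranspose_mul_self hQ
  have h : (Xᴴ * X * (Yᴴ * Y)).trace.re = ‖X * Yᴴ‖ ^ 2 := by
    rw [← key, Matrix.conjTranspose_mul, Matrix.conjTranspose_conjTranspose,
      ← Matrix.mul_assoc, Matrix.trace_mul_comm]
    simp only [Matrix.mul_assoc]
  rw [h, key, key, ← mul_pow]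
  refine ⟨by positivity, pow_le_pow_left₀ (norm_nonneg _) ?_ 2⟩
  calc ‖X * Yᴴ‖ ≤ ‖X‖ * ‖Yᴴ‖ := Matrix.frobenius_norm_mul _ _
    _ = ‖X‖ * ‖Y‖ := by rw [Matrix.frobenius_norm_conjTranspose]

theorem sum_fin_three {β : Type*} [AddCommMonoid β] (F : (Fin 3 → α) → β) :
    ∑ f, F f = ∑ a, ∑ b, ∑ c, F ![a, b, c] := by
  let e : (α × α × α) ≃ (Fin 3 → α) :=
    { toFun := fun t => ![t.1, t.2.1, t.2.2]
      invFun := fun f => (f 0, f 1, f 2)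
      left_inv := fun t => rfl
      right_inv := fun f => by ext i; fin_cases i <;> rfl }
  rw [← e.sum_comp, Fintype.sum_prod_type]
  exact Finset.sum_congr rfl fun a _ => Fintype.sum_prod_type _

theorem sum_fin_three_mul (F G H : α → ℂ) :
    ∑ f : Fin 3 → α, F (f 0) * G (f 1) * H (f 2) = (∑ a, F a) * (∑ a, G a) * ∑ a, H a := by
  rw [sum_fin_three, Finset.sum_mul_sum, Finset.sum_mul]
  refine Finset.sum_congr rfl fun a _ => ?_
  rw [Finset.sum_mul]
  refine Finset.sum_congr rfl fun b _ => ?_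
  rw [Finset.mul_sum]
  rfl

/-- The quadratic form `⟨v|A|v⟩`. -/
noncomputable def quad (v : α → ℂ) (A : Matrix α α ℂ) : ℂ := star v ⬝ᵥ A *ᵥ v

theorem quad_eq_re {A : Matrix α α ℂ} (hA : A.PosSemidef) (v : α → ℂ) :
    quad v A = ((quad v A).re : ℂ) := by
  have h := hA.dotProduct_mulVec_nonneg v
  exact (Complex.ext rfl (Complex.le_def.1 h).2.symm)

theorem trace_vecMulVec_mul (v : α → ℂ) (A : Matrix α α ℂ) :
    (vecMulVec v (star v) * A).trace = quad v A := by
  rw [Matrix.vecMulVec_mul, Matrix.trace_vecMulVec, dotProduct_comm, quad,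
    Matrix.dotProduct_mulVec]

theorem trace_eq_re {A : Matrix α α ℂ} (hA : A.PosSemidef) :
    A.trace = (A.trace.re : ℂ) :=
  Complex.ext rfl (Complex.le_def.1 hA.trace_nonneg).2.symm

theorem quad_star_mulVec (U A : Matrix α α ℂ) (v : α → ℂ) :
    quad (star (U *ᵥ v)) A = quad v (Uᴴ * Aᵀ * U) := by
  rw [quad, quad, star_star, ← Matrix.mulVec_mulVec, ← Matrix.mulVec_mulVec,
    Matrix.dotProduct_mulVec (star v), ← Matrix.star_mulVec, dotProduct_comm,
    Matrix.dotProduct_mulVec (star _), Matrix.vecMul_transpose]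

end General

variable {n : ℕ}

theorem kron3Q_mul (A B C A' B' C' : Matrix (QVec n) (QVec n) ℂ) :
    kron3Q A B C * kron3Q A' B' C' = kron3Q (A * A') (B * B') (C * C') := by
  ext a b
  simp only [Matrix.mul_apply, kron3Q]
  rw [← sum_fin_three_mul (fun j => A (a 0) j * A' j (b 0)) (fun j => B (a 1) j * B' j (b 1))
    (fun j => C (a 2) j * C' j (b 2))]
  exact Finset.sum_congr rfl fun f _ => by ring

theorem kron3Q_posSemidef {A B C : Matrix (QVec n) (QVec n) ℂ} (hA : A.PosSemidef)
    (hB : B.PosSemidef) (hC : C.PosSemidef) : (kron3Q A B C).PosSemidef := by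
  obtain ⟨X, rfl⟩ := exists_eq_conjTranspose_mul_self hA
  obtain ⟨Y, rfl⟩ := exists_eq_conjTranspose_mul_self hB
  obtain ⟨Z, rfl⟩ := exists_eq_conjTranspose_mul_self hC
  rw [← kron3Q_mul]
  have h : kron3Q Xᴴ Yᴴ Zᴴ = (kron3Q X Y Z)ᴴ := by
    ext a b
    simp [kron3Q, Matrix.conjTranspose_apply]
  rw [h]
  exact Matrix.posSemidef_conjTranspose_mul_self _

theorem trace_outer3_mul (v : QVec n → ℂ) (A B C : Matrix (QVec n) (QVec n) ℂ) :
    (outer3 v * kron3Q A B C).trace = quad v A * quad v B * quad v C := by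
  rw [outer3, trace_vecMulVec_mul]
  have h : kron3Q A B C *ᵥ tpow3 v =
      fun a => (A *ᵥ v) (a 0) * (B *ᵥ v) (a 1) * (C *ᵥ v) (a 2) := by
    ext a
    simp only [Matrix.mulVec, dotProduct, kron3Q, tpow3, Fin.prod_univ_three]
    rw [← sum_fin_three_mul (fun j => A (a 0) j * v j) (fun j => B (a 1) j * v j)
      (fun j => C (a 2) j * v j)]
    exact Finset.sum_congr rfl fun f _ => by ring
  rw [quad, h]
  simp only [quad, dotProduct]
  rw [← sum_fin_three_mul]
  refine Finset.sum_congr rfl fun f _ => ?_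
  simp only [tpow3, Fin.prod_univ_three, Pi.star_apply, star_mul']
  ring

theorem trace_permOp3Q_mul (π : Equiv.Perm (Fin 3)) (A B C : Matrix (QVec n) (QVec n) ℂ) :
    (permOp3Q n π * kron3Q A B C).trace =
      ∑ a, ∑ b, ∑ c, kron3Q A B C ![a, b, c] (![a, b, c] ∘ π) := by
  rw [← sum_fin_three fun f => kron3Q A B C f (f ∘ π), Matrix.trace_mul_comm]
  simp [Matrix.trace, Matrix.mul_apply, permOp3Q]

theorem univ_perm_fin_three : (univ : Finset (Equiv.Perm (Fin 3))) =
    {1, Equiv.swap 0 1, Equiv.swap 0 2, Equiv.swap 1 2,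
      Equiv.swap 0 1 * Equiv.swap 1 2, Equiv.swap 1 2 * Equiv.swap 0 1} := by
  decide

theorem sum_perm_fin_three {β : Type*} [AddCommMonoid β] (F : Equiv.Perm (Fin 3) → β) :
    ∑ π, F π = F 1 + (F (Equiv.swap 0 1) + (F (Equiv.swap 0 2) + (F (Equiv.swap 1 2) +
      (F (Equiv.swap 0 1 * Equiv.swap 1 2) + F (Equiv.swap 1 2 * Equiv.swap 0 1))))) := by
  rw [univ_perm_fin_three]
  iterate 5 rw [Finset.sum_insert (by decide)]
  rw [Finset.sum_singleton]

theorem trace_haar3Q_mul (A B C : Matrix (QVec n) (QVec n) ℂ) :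
    (haar3Q n * kron3Q A B C).trace =
      ((2 ^ n : ℂ) * ((2 ^ n : ℂ) + 1) * ((2 ^ n : ℂ) + 2))⁻¹ *
        (A.trace * B.trace * C.trace + (A * B).trace * C.trace + (A * C).trace * B.trace +
          (B * C).trace * A.trace + (A * B * C).trace + (A * C * B).trace) := by
  have e1 : ∑ a, ∑ b, ∑ c, A a a * B b b * C c c = A.trace * B.trace * C.trace := by
    simp only [Matrix.trace, Matrix.diag_apply, ← Finset.mul_sum, ← Finset.sum_mul]
  have e2 : ∑ a, ∑ b, ∑ c, A a b * B b a * C c c = (A * B).trace * C.trace := by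
    simp only [Matrix.trace, Matrix.diag_apply, Matrix.mul_apply, ← Finset.mul_sum,
      ← Finset.sum_mul]
  have e3 : ∑ a, ∑ b, ∑ c, A a c * B b b * C c a = (A * C).trace * B.trace := by
    simp only [fun a b c => mul_right_comm (A a c) (B b b) (C c a), Matrix.trace,
      Matrix.diag_apply, Matrix.mul_apply, ← Finset.mul_sum, ← Finset.sum_mul]
  have e4 : ∑ a, ∑ b, ∑ c, A a a * B b c * C c b = (B * C).trace * A.trace := by
    simp only [Matrix.trace, Matrix.diag_apply, Matrix.mul_apply, mul_assoc, ← Finset.mul_sum,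
      ← Finset.sum_mul]
    rw [mul_comm]
  have e5 : ∑ a, ∑ b, ∑ c, A a b * B b c * C c a = (A * B * C).trace := by
    simp only [Matrix.trace, Matrix.diag_apply, Matrix.mul_apply, Finset.sum_mul]
    exact Finset.sum_congr rfl fun a _ => Finset.sum_comm
  have e6 : ∑ a, ∑ b, ∑ c, A a c * B b a * C c b = (A * C * B).trace := by
    simp only [Matrix.trace, Matrix.diag_apply, Matrix.mul_apply, Finset.sum_mul]
    exact Finset.sum_congr rfl fun a _ => Finset.sum_congr rfl fun b _ =>
      Finset.sum_congr rfl fun c _ => by ring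
  rw [haar3Q, Matrix.smul_mul, Matrix.smul_mul, Matrix.trace_smul, Matrix.trace_smul,
    Finset.sum_mul, Matrix.trace_sum, sum_perm_fin_three]
  simp only [trace_permOp3Q_mul, kron3Q, Function.comp_apply]
  have s1 : Equiv.swap (0 : Fin 3) 1 2 = 2 := by decide
  have s2 : Equiv.swap (0 : Fin 3) 2 1 = 1 := by decide
  have s3 : Equiv.swap (1 : Fin 3) 2 0 = 0 := by decide
  simp only [Fin.isValue, Equiv.Perm.coe_one, id_eq, Equiv.swap_apply_left,
    Equiv.swap_apply_right, Equiv.Perm.coe_mul, Function.comp_apply, s1, s2, s3,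
    Matrix.cons_val, e1, e2, e3, e4, e5, e6, smul_eq_mul]
  rw [inv_div, ← mul_assoc, div_mul_eq_mul_div, mul_inv_cancel₀ (by norm_num), one_div]
  ring

section Design

variable {ε : ℝ} {ι : Type} [Fintype ι] {w : ι → ℝ} {ζ : ι → QVec n → ℂ}
  {A B C : Matrix (QVec n) (QVec n) ℂ}

theorem trace_design_mul (hA : A.PosSemidef) (hB : B.PosSemidef) (hC : C.PosSemidef) :
    ((∑ i, w i • outer3 (ζ i)) * kron3Q A B C).trace.re =
      ∑ i, w i * ((quad (ζ i) A).re * (quad (ζ i) B).re * (quad (ζ i) C).re) := by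
  rw [Finset.sum_mul, Matrix.trace_sum, Complex.re_sum]
  refine Finset.sum_congr rfl fun i _ => ?_
  rw [Matrix.smul_mul, Matrix.trace_smul, Complex.smul_re, trace_outer3_mul, quad_eq_re hA,
    quad_eq_re hB, quad_eq_re hC]
  norm_cast

theorem design_le (h : ((1 + ε) • haar3Q n - ∑ i, w i • outer3 (ζ i)).PosSemidef)
    (hA : A.PosSemidef) (hB : B.PosSemidef) (hC : C.PosSemidef) :
    ∑ i, w i * ((quad (ζ i) A).re * (quad (ζ i) B).re * (quad (ζ i) C).re) ≤
      (1 + ε) * (haar3Q n * kron3Q A B C).trace.re := by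
  have := (trace_mul_bounds h (kron3Q_posSemidef hA hB hC)).1
  rw [sub_mul, Matrix.trace_sub, Complex.sub_re, trace_design_mul hA hB hC, Matrix.smul_mul,
    Matrix.trace_smul, Complex.smul_re, smul_eq_mul] at this
  linarith

theorem le_design (h : ((∑ i, w i • outer3 (ζ i)) - (1 - ε) • haar3Q n).PosSemidef)
    (hA : A.PosSemidef) (hB : B.PosSemidef) (hC : C.PosSemidef) :
    (1 - ε) * (haar3Q n * kron3Q A B C).trace.re ≤
      ∑ i, w i * ((quad (ζ i) A).re * (quad (ζ i) B).re * (quad (ζ i) C).re) := by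
  have := (trace_mul_bounds h (kron3Q_posSemidef hA hB hC)).1
  rw [sub_mul, Matrix.trace_sub, Complex.sub_re, trace_design_mul hA hB hC, Matrix.smul_mul,
    Matrix.trace_smul, Complex.smul_re, smul_eq_mul] at this
  linarith

end Design

theorem pauliX_unitary (x : QVec n) : (pauliX x)ᴴ * pauliX x = 1 := by
  ext a b
  simp [Matrix.mul_apply, pauliX, Matrix.one_apply, apply_ite, eq_comm]

/-- The sign character `(-1)^(z·a)`. -/
noncomputable def chi (z a : QVec n) : ℂ := (-1 : ℂ) ^ (∑ i, (z i).val * (a i).val)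

theorem chi_mul_self (z a : QVec n) : chi z a * chi z a = 1 := by
  rw [chi, ← mul_pow]; norm_num

theorem star_chi (z a : QVec n) : star (chi z a) = chi z a := by
  simp [chi]

theorem sum_chi_mul_chi (c d : QVec n) :
    ∑ z, chi z c * chi z d = if c = d then (2 ^ n : ℂ) else 0 := by
  have h : ∀ z : QVec n, chi z c * chi z d =
      ∏ i, ((-1 : ℂ) ^ ((z i).val * (c i).val) * (-1 : ℂ) ^ ((z i).val * (d i).val)) := by
    intro z
    rw [chi, chi, ← Finset.prod_pow_eq_pow_sum, ← Finset.prod_pow_eq_pow_sum,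
      Finset.prod_mul_distrib]
  simp only [h]
  rw [← Fintype.piFinset_univ, ← Finset.prod_univ_sum (fun _ => univ)
    fun i (k : Fin 2) => (-1 : ℂ) ^ (k.val * (c i).val) * (-1 : ℂ) ^ (k.val * (d i).val)]
  have h2 : ∀ i, ∑ k : Fin 2, (-1 : ℂ) ^ (k.val * (c i).val) * (-1 : ℂ) ^ (k.val * (d i).val) =
      if c i = d i then 2 else 0 := by
    intro i
    generalize c i = s
    generalize d i = t
    fin_cases s <;> fin_cases t <;> norm_num
  simp only [h2]
  rw [Finset.prod_ite_zero]
  simp [funext_iff]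

theorem pauliZ_unitary (z : QVec n) : (pauliZ z)ᴴ * pauliZ z = 1 := by
  have h : pauliZ z = Matrix.diagonal (chi z) := by
    ext a b
    simp [pauliZ, Matrix.diagonal_apply, chi]
  have h' : star (chi z) = chi z := funext fun a => star_chi z a
  rw [h, Matrix.diagonal_conjTranspose, Matrix.diagonal_mul_diagonal, h']
  simp [chi_mul_self]

theorem pauli_unitary (x z : QVec n) :
    (pauliX x * pauliZ z)ᴴ * (pauliX x * pauliZ z) = 1 := by
  rw [Matrix.conjTranspose_mul, Matrix.mul_assoc, ← Matrix.mul_assoc (pauliX x)ᴴ,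
    pauliX_unitary, Matrix.one_mul, pauliZ_unitary]

theorem shiftConj_apply (ζ : QVec n → ℂ) (x z a : QVec n) :
    shiftConj ζ x z a = chi z (a - x) * star (ζ (a - x)) := by
  have h : ((pauliX x * pauliZ z) *ᵥ ζ) a = chi z (a - x) * ζ (a - x) := by
    rw [← Matrix.mulVec_mulVec]
    simp [Matrix.mulVec, dotProduct, pauliX, pauliZ, chi, ← sub_eq_iff_eq_add]
  rw [shiftConj, Pi.star_apply, h, star_mul', star_chi]

/-- The Pauli twirl of a pure state is maximally mixed. -/
theorem sum_quad_shiftConj {ζ : QVec n → ℂ} (hζ : star ζ ⬝ᵥ ζ = 1)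
    (A : Matrix (QVec n) (QVec n) ℂ) :
    ∑ x, ∑ z, quad (shiftConj ζ x z) A = 2 ^ n * A.trace := by
  have h : ∀ x, ∑ z, quad (shiftConj ζ x z) A =
      2 ^ n * ∑ a, A a a * (star (ζ (a - x)) * ζ (a - x)) := by
    intro x
    calc ∑ z, quad (shiftConj ζ x z) A
        = ∑ z, ∑ a, ∑ b, (A a b * (star (ζ (b - x)) * ζ (a - x))) *
            (chi z (a - x) * chi z (b - x)) := by
          refine Finset.sum_congr rfl fun z _ => ?_
          simp only [quad, dotProduct, Matrix.mulVec, Finset.mul_sum, Pi.star_apply,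
            shiftConj_apply, star_mul', star_chi, star_star]
          exact Finset.sum_congr rfl fun a _ => Finset.sum_congr rfl fun b _ => by ring
      _ = ∑ a, ∑ b, (A a b * (star (ζ (b - x)) * ζ (a - x))) *
            (if a = b then (2 ^ n : ℂ) else 0) := by
          rw [Finset.sum_comm]
          refine Finset.sum_congr rfl fun a _ => ?_
          rw [Finset.sum_comm]
          refine Finset.sum_congr rfl fun b _ => ?_
          rw [← Finset.mul_sum, sum_chi_mul_chi]
          simp only [sub_left_inj]
      _ = _ := by
          rw [Finset.mul_sum]
          refine Finset.sum_congr rfl fun a _ => ?_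
          simp [mul_comm]
  simp only [h]
  rw [← Finset.mul_sum, Finset.sum_comm]
  congr 1
  refine Finset.sum_congr rfl fun a _ => ?_
  have h1 : ∑ x, star (ζ (a - x)) * ζ (a - x) = 1 :=
    ((Equiv.subLeft a).sum_comp fun b => star (ζ b) * ζ b).trans hζ
  rw [← Finset.mul_sum, h1, mul_one, Matrix.diag_apply]

section Conjugation

variable {ε : ℝ} {ι : Type} [Fintype ι] {w : ι → ℝ} {ζ : ι → QVec n → ℂ}
  {U ρ O : Matrix (QVec n) (QVec n) ℂ}

theorem conj_transpose_mul (hU : Uᴴ * U = 1) (A B : Matrix (QVec n) (QVec n) ℂ) :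
    (Uᴴ * Aᵀ * U) * (Uᴴ * Bᵀ * U) = Uᴴ * (B * A)ᵀ * U := by
  have hU' := mul_eq_one_comm.mp hU
  rw [Matrix.transpose_mul]
  calc _ = Uᴴ * Aᵀ * (U * Uᴴ) * Bᵀ * U := by simp only [Matrix.mul_assoc]
    _ = _ := by rw [hU', Matrix.mul_one]; simp only [Matrix.mul_assoc]

theorem trace_conj_transpose (hU : Uᴴ * U = 1) (A : Matrix (QVec n) (QVec n) ℂ) :
    (Uᴴ * Aᵀ * U).trace = A.trace := by
  rw [Matrix.trace_mul_comm, ← Matrix.mul_assoc, mul_eq_one_comm.mp hU, Matrix.one_mul,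
    Matrix.trace_transpose]

theorem third_moment_le (h : ((1 + ε) • haar3Q n - ∑ i, w i • outer3 (ζ i)).PosSemidef)
    (hρ : ρ.PosSemidef) (hρtr : ρ.trace = 1) (hO : O.PosSemidef) (hU : Uᴴ * U = 1) :
    ∑ i, w i * ((quad (star (U *ᵥ ζ i)) ρ).re * (quad (star (U *ᵥ ζ i)) O).re ^ 2) ≤
      (1 + ε) * (((2 ^ n : ℝ) * (2 ^ n + 1) * (2 ^ n + 2))⁻¹ *
        (O.trace.re ^ 2 + 2 * O.trace.re * (ρ * O).trace.re + (O * O).trace.re +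
          2 * (ρ * (O * O)).trace.re)) := by
  have hR := hρ.transpose.conjTranspose_mul_mul_same U
  have hB := hO.transpose.conjTranspose_mul_mul_same U
  have key := design_le h hR hB hB
  rw [trace_haar3Q_mul] at key
  simp only [conj_transpose_mul hU, trace_conj_transpose hU, ← quad_star_mulVec] at key
  convert key using 1
  · exact Finset.sum_congr rfl fun i _ => by ring
  · congr 1
    have e : (O * (O * ρ)).trace = (ρ * (O * O)).trace := by
      rw [← Matrix.mul_assoc, Matrix.trace_mul_comm]
    rw [e, Matrix.trace_mul_comm O ρ, hρtr, trace_eq_re hO]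
    have e2 : ((2 ^ n : ℂ) * (2 ^ n + 1) * (2 ^ n + 2))⁻¹ =
      ((((2 ^ n : ℝ) * (2 ^ n + 1) * (2 ^ n + 2))⁻¹ : ℝ) : ℂ) := by push_cast; rfl
    rw [e2, Complex.re_ofReal_mul]
    simp
    left; ring

theorem le_second_moment (hζ : ∀ i, star (ζ i) ⬝ᵥ ζ i = 1)
    (h : ((∑ i, w i • outer3 (ζ i)) - (1 - ε) • haar3Q n).PosSemidef)
    (hρ : ρ.PosSemidef) (hρtr : ρ.trace = 1) (hO : O.PosSemidef) (hU : Uᴴ * U = 1) :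
    (1 - ε) * (((2 ^ n : ℝ) * (2 ^ n + 1))⁻¹ * (O.trace.re + (ρ * O).trace.re)) ≤
      ∑ i, w i * ((quad (star (U *ᵥ ζ i)) ρ).re * (quad (star (U *ᵥ ζ i)) O).re) := by
  have hR := hρ.transpose.conjTranspose_mul_mul_same U
  have hB := hO.transpose.conjTranspose_mul_mul_same U
  have key := le_design h hR hB Matrix.PosSemidef.one
  rw [trace_haar3Q_mul] at key
  simp only [conj_transpose_mul hU, trace_conj_transpose hU, ← quad_star_mulVec,
    Matrix.mul_one] at key
  have hq : ∀ i, quad (ζ i) 1 = 1 := fun i => by rw [quad, Matrix.one_mulVec, hζ]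
  convert key using 1
  · congr 1
    rw [Matrix.trace_mul_comm O ρ, hρtr, trace_eq_re hO]
    have e2 : ((2 ^ n : ℂ) * (2 ^ n + 1) * (2 ^ n + 2))⁻¹ =
      ((((2 ^ n : ℝ) * (2 ^ n + 1) * (2 ^ n + 2))⁻¹ : ℝ) : ℂ) := by push_cast; rfl
    have e3 : (1 : Matrix (QVec n) (QVec n) ℂ).trace = ((2 ^ n : ℝ) : ℂ) := by
      simp [Matrix.trace_one]
    rw [e2, e3, Complex.re_ofReal_mul]
    simp only [Complex.add_re, Complex.re_mul_ofReal, Complex.ofReal_re, one_mul, mul_one]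
    field_simp
    ring
  · exact Finset.sum_congr rfl fun i _ => by rw [hq, Complex.one_re, mul_one]

end Conjugation

/-- The centred observable `A = O - (Tr O / N) I` satisfies `0 ≤ Tr A²` and
`Tr (ρ A²) ≤ Tr A²`, both sides being expanded in moments of `O`. -/
theorem trace_sub_smul_one_bounds {ρ O : Matrix (QVec n) (QVec n) ℂ} (hρ : ρ.PosSemidef)
    (hρtr : ρ.trace = 1) (hO : O.PosSemidef) :
    ((O - (O.trace / (2 ^ n : ℂ)) • 1) * (O - (O.trace / (2 ^ n : ℂ)) • 1)).trace.re =
      (O * O).trace.re - O.trace.re ^ 2 / 2 ^ n ∧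
    0 ≤ (O * O).trace.re - O.trace.re ^ 2 / 2 ^ n ∧
    (ρ * (O * O)).trace.re - 2 * (O.trace.re / 2 ^ n) * (ρ * O).trace.re +
      O.trace.re ^ 2 / (2 ^ n) ^ 2 ≤ (O * O).trace.re - O.trace.re ^ 2 / 2 ^ n := by
  obtain ⟨T, hT⟩ : ∃ T : ℝ, O.trace = T := ⟨_, trace_eq_re hO⟩
  have ht : O.trace / (2 ^ n : ℂ) = ((T / 2 ^ n : ℝ) : ℂ) := by rw [hT]; push_cast; rfl
  have hTre : O.trace.re = T := by rw [hT, Complex.ofReal_re]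
  rw [ht, hTre]
  set t : ℝ := T / 2 ^ n with h_t
  have hsq : (O - (t : ℂ) • 1) * (O - (t : ℂ) • 1) =
      O * O - (2 * t : ℂ) • O + (t ^ 2 : ℂ) • 1 := by
    simp only [sub_mul, mul_sub, Matrix.smul_mul, Matrix.mul_smul, Matrix.one_mul,
      Matrix.mul_one]
    module
  have hA : (O - (t : ℂ) • 1)ᴴ = O - (t : ℂ) • 1 := by
    rw [Matrix.conjTranspose_sub, hO.isHermitian.eq, Matrix.conjTranspose_smul]
    simp
  have hpsd := Matrix.posSemidef_conjTranspose_mul_self (O - (t : ℂ) • 1)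
  rw [hA] at hpsd
  have htr : ((O - (t : ℂ) • 1) * (O - (t : ℂ) • 1)).trace.re =
      (O * O).trace.re - T ^ 2 / 2 ^ n := by
    have e3 : (1 : Matrix (QVec n) (QVec n) ℂ).trace = ((2 ^ n : ℝ) : ℂ) := by
      simp [Matrix.trace_one]
    rw [hsq, Matrix.trace_add, Matrix.trace_sub, Matrix.trace_smul, Matrix.trace_smul, hT, e3]
    simp only [smul_eq_mul]
    norm_cast
    simp only [Complex.add_re, Complex.sub_re, Complex.ofReal_re]
    rw [h_t]
    push_cast
    field_simp
    ring
  have htrρ : (ρ * ((O - (t : ℂ) • 1) * (O - (t : ℂ) • 1))).trace.re =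
      (ρ * (O * O)).trace.re - 2 * t * (ρ * O).trace.re + t ^ 2 := by
    rw [hsq, mul_add, mul_sub, Matrix.mul_smul, Matrix.mul_smul, Matrix.mul_one,
      Matrix.trace_add, Matrix.trace_sub, Matrix.trace_smul, Matrix.trace_smul, hρtr]
    simp only [smul_eq_mul, mul_one]
    norm_cast
    simp only [Complex.add_re, Complex.sub_re, Complex.ofReal_re, Complex.re_ofReal_mul]
  have hle := (trace_mul_bounds hρ hpsd).2
  have h0 := (Complex.le_def.1 hpsd.trace_nonneg).1
  rw [hρtr, Complex.one_re, one_mul, htrρ, htr] at hle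
  rw [htr] at h0
  refine ⟨htr, h0, ?_⟩
  rwa [← div_pow]

/-- The real arithmetic of the variance bound. -/
theorem variance_arith {N ε T a b c X₂ X₃ : ℝ} (hN : 4 ≤ N) (hε : 0 ≤ ε) (hT : 0 ≤ T)
    (ha : a ≤ T) (hb : b ≤ T ^ 2) (hc : c ≤ T ^ 2)
    (hD : 0 ≤ b - T ^ 2 / N)
    (hcb : c - 2 * (T / N) * a + T ^ 2 / N ^ 2 ≤ b - T ^ 2 / N)
    (h₃ : X₃ ≤ N ^ 2 * ((1 + ε) * ((N * (N + 1) * (N + 2))⁻¹ *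
      (T ^ 2 + 2 * T * a + b + 2 * c))))
    (h₂ : N ^ 2 * ((1 - ε) * ((N * (N + 1))⁻¹ * (T + a))) ≤ X₂) :
    (N + 1) ^ 2 * X₃ / N - 2 * (N + 1) * T * X₂ / N + T ^ 2 - ((N + 1) * X₂ / N - T) ^ 2 ≤
      3 * (b - T ^ 2 / N) + 10 * ε * T ^ 2 := by
  have hN0 : 0 < N := by linarith
  have hsq := sq_nonneg ((N + 1) * X₂ / N - T - T / N)
  have k₃ : (N + 1) ^ 2 * X₃ / N ≤
      (1 + ε) * ((N + 1) / (N + 2) * (T ^ 2 + 2 * T * a + b + 2 * c)) := by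
    calc (N + 1) ^ 2 * X₃ / N = (N + 1) ^ 2 / N * X₃ := by ring
      _ ≤ (N + 1) ^ 2 / N * _ := mul_le_mul_of_nonneg_left h₃ (by positivity)
      _ = _ := by field_simp
  have k₂ : (1 - ε) * (2 * (N + 1) / N * T * (T + a)) ≤ 2 * (N + 1) ^ 2 * T / N ^ 2 * X₂ := by
    calc _ = 2 * (N + 1) ^ 2 * T / N ^ 2 * (N ^ 2 * ((1 - ε) * ((N * (N + 1))⁻¹ * (T + a)))) := by
          field_simp
      _ ≤ _ := mul_le_mul_of_nonneg_left h₂ (by positivity)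
  have hrew : (N + 1) ^ 2 * X₃ / N - 2 * (N + 1) * T * X₂ / N + T ^ 2 -
      ((N + 1) * X₂ / N - T) ^ 2 = (N + 1) ^ 2 * X₃ / N - 2 * (N + 1) ^ 2 * T / N ^ 2 * X₂ +
      T ^ 2 * (N + 1) ^ 2 / N ^ 2 - ((N + 1) * X₂ / N - T - T / N) ^ 2 := by
    field_simp; ring
  have hmain : (N + 1) / (N + 2) * (T ^ 2 + 2 * T * a + b + 2 * c) -
      2 * (N + 1) / N * T * (T + a) + T ^ 2 * (N + 1) ^ 2 / N ^ 2 ≤ 3 * (b - T ^ 2 / N) := by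
    have e : (N + 1) / (N + 2) * (T ^ 2 + 2 * T * a + b + 2 * c) -
        2 * (N + 1) / N * T * (T + a) + T ^ 2 * (N + 1) ^ 2 / N ^ 2 =
        (N + 1) / (N + 2) * (b - T ^ 2 / N + 2 * (c - 2 * (T / N) * a + T ^ 2 / N ^ 2)) := by
      field_simp; ring
    rw [e]
    calc _ ≤ (N + 1) / (N + 2) * (3 * (b - T ^ 2 / N)) := by gcongr; linarith
      _ ≤ 1 * (3 * (b - T ^ 2 / N)) := by
        gcongr
        rw [div_le_one (by positivity)]
        linarith
      _ = _ := one_mul _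
  have herr : (N + 1) / (N + 2) * (T ^ 2 + 2 * T * a + b + 2 * c) +
      2 * (N + 1) / N * T * (T + a) ≤ 10 * T ^ 2 := by
    have u₁ : T ^ 2 + 2 * T * a + b + 2 * c ≤ 6 * T ^ 2 := by nlinarith
    have u₂ : T * (T + a) ≤ 2 * T ^ 2 := by nlinarith
    calc _ = (N + 1) / (N + 2) * (T ^ 2 + 2 * T * a + b + 2 * c) +
          2 * (N + 1) / N * (T * (T + a)) := by ring
      _ ≤ (N + 1) / (N + 2) * (6 * T ^ 2) + 2 * (N + 1) / N * (2 * T ^ 2) := by gcongr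
      _ = (6 * (N + 1) / (N + 2) + 4 * (N + 1) / N) * T ^ 2 := by ring
      _ ≤ 10 * T ^ 2 := by
        gcongr
        rw [div_add_div _ _ (by positivity) (by positivity), div_le_iff₀ (by positivity)]
        nlinarith
  have := mul_le_mul_of_nonneg_left herr hε
  nlinarith

end ShadowVariance

/-- Variance bound for a relative `ε`-approximate state 3-design over `n ≥ 2` qubits: for
positive `O`, the state-based classical shadow satisfies
`Var[Tr(Oρ̂)] ≤ 3·Tr(O₀²) + 10ε·Tr(O)²` where `O₀ = O − (Tr(O)/2^n)·I`. -/
theorem stmt8 (n : ℕ) (hn : 2 ≤ n) (ε : ℝ) (hε : 0 ≤ ε) {ι : Type} [Fintype ι]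
    (w : ι → ℝ) (hw : ∀ i, 0 ≤ w i) (hw1 : ∑ i, w i = 1)
    (ζ : ι → QVec n → ℂ) (hζ : ∀ i, star (ζ i) ⬝ᵥ ζ i = 1)
    (hrel₁ : ((∑ i, w i • outer3 (ζ i)) - (1 - ε) • haar3Q n).PosSemidef)
    (hrel₂ : ((1 + ε) • haar3Q n - ∑ i, w i • outer3 (ζ i)).PosSemidef)
    (ρ O : Matrix (QVec n) (QVec n) ℂ)
    (hρ : ρ.PosSemidef) (hρtr : ρ.trace = 1) (hO : O.PosSemidef)
    (p : ι → QVec n → QVec n → ℝ)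
    (hp : ∀ i x z, p i x z =
      (1 / (2 ^ n : ℝ)) *
        ((star (shiftConj (ζ i) x z) ⬝ᵥ ρ.mulVec (shiftConj (ζ i) x z)).re))
    (val : ι → QVec n → QVec n → ℝ)
    (hval : ∀ i x z, val i x z =
      ((O * (((2 ^ n : ℂ) + 1) • outer (shiftConj (ζ i) x z) - 1)).trace).re)
    (Eest Var : ℝ)
    (hE : Eest = ∑ i, w i * ∑ x : QVec n, ∑ z : QVec n, p i x z * val i x z)
    (hVar : Var =
      (∑ i, w i * ∑ x : QVec n, ∑ z : QVec n, p i x z * (val i x z) ^ 2) - Eest ^ 2) :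
    Var ≤ 3 * (((O - (O.trace / (2 ^ n : ℂ)) • 1) *
          (O - (O.trace / (2 ^ n : ℂ)) • 1)).trace).re +
        10 * ε * ((O.trace).re) ^ 2 := by
  set N : ℝ := 2 ^ n with hNdef
  have hN : 4 ≤ N := by
    calc (4 : ℝ) = 2 ^ 2 := by norm_num
      _ ≤ 2 ^ n := pow_le_pow_right₀ (by norm_num) hn
  have hN0 : N ≠ 0 := by positivity
  obtain ⟨hO₀, hD, hcb⟩ := ShadowVariance.trace_sub_smul_one_bounds hρ hρtr hO
  have hT : 0 ≤ O.trace.re := (Complex.le_def.1 hO.trace_nonneg).1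
  have hρre : ρ.trace.re = 1 := by rw [hρtr]; rfl
  have ha := (ShadowVariance.trace_mul_bounds hρ hO).2
  have hb := (ShadowVariance.trace_mul_bounds hO hO).2
  have hOO : (O * O).PosSemidef := by
    have := Matrix.posSemidef_conjTranspose_mul_self O
    rwa [hO.isHermitian.eq] at this
  have hc := (ShadowVariance.trace_mul_bounds hρ hOO).2
  rw [hρre, one_mul] at ha hc
  rw [← pow_two O.trace.re] at hb
  set r : ι → QVec n → QVec n → ℝ :=
    fun i x z => (ShadowVariance.quad (shiftConj (ζ i) x z) ρ).re with hr
  set o : ι → QVec n → QVec n → ℝ :=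
    fun i x z => (ShadowVariance.quad (shiftConj (ζ i) x z) O).re with ho
  set T := O.trace.re with hTdef
  have hswap : ∀ F : ι → QVec n → QVec n → ℝ,
      ∑ i, w i * ∑ x, ∑ z, F i x z = ∑ x, ∑ z, ∑ i, w i * F i x z := by
    intro F
    simp only [Finset.mul_sum]
    rw [Finset.sum_comm]
    exact Finset.sum_congr rfl fun x _ => Finset.sum_comm
  have hconst : ∀ c : ℝ, ∑ _x : QVec n, ∑ _z : QVec n, c = N ^ 2 * c := by
    intro c
    simp [hNdef]
    ring
  have h₃ : ∑ i, w i * ∑ x, ∑ z, r i x z * o i x z ^ 2 ≤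
      N ^ 2 * ((1 + ε) * ((N * (N + 1) * (N + 2))⁻¹ *
        (T ^ 2 + 2 * T * (ρ * O).trace.re + (O * O).trace.re + 2 * (ρ * (O * O)).trace.re))) := by
    rw [hswap, ← hconst]
    exact Finset.sum_le_sum fun x _ => Finset.sum_le_sum fun z _ =>
      ShadowVariance.third_moment_le hrel₂ hρ hρtr hO (ShadowVariance.pauli_unitary x z)
  have h₂ : N ^ 2 * ((1 - ε) * ((N * (N + 1))⁻¹ * (T + (ρ * O).trace.re))) ≤
      ∑ i, w i * ∑ x, ∑ z, r i x z * o i x z := by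
    rw [hswap, ← hconst]
    exact Finset.sum_le_sum fun x _ => Finset.sum_le_sum fun z _ =>
      ShadowVariance.le_second_moment hζ hrel₁ hρ hρtr hO (ShadowVariance.pauli_unitary x z)
  have h₁ : ∑ i, w i * ∑ x, ∑ z, r i x z = N := by
    have : ∀ i, ∑ x, ∑ z, r i x z = N := by
      intro i
      have h := congrArg Complex.re (ShadowVariance.sum_quad_shiftConj (hζ i) ρ)
      rw [hρtr, mul_one] at h
      simp only [Complex.re_sum] at h
      rw [hr, h, hNdef]
      norm_cast
    simp only [this, ← Finset.sum_mul, hw1, one_mul]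
  have hp' : ∀ i x z, p i x z = 1 / N * r i x z := hp
  have hval' : ∀ i x z, val i x z = (N + 1) * o i x z - T := by
    intro i x z
    rw [hval, mul_sub, Matrix.mul_smul, Matrix.mul_one, Matrix.trace_sub, Matrix.trace_smul,
      Matrix.trace_mul_comm, outer, ShadowVariance.trace_vecMulVec_mul]
    have e : (2 ^ n : ℂ) + 1 = ((N + 1 : ℝ) : ℂ) := by rw [hNdef]; push_cast; rfl
    rw [e, smul_eq_mul, Complex.sub_re, Complex.re_ofReal_mul]
  have hfirst : Eest = (N + 1) * (∑ i, w i * ∑ x, ∑ z, r i x z * o i x z) / N - T := by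
    have : Eest = 1 / N * ((N + 1) * (∑ i, w i * ∑ x, ∑ z, r i x z * o i x z) -
        T * ∑ i, w i * ∑ x, ∑ z, r i x z) := by
      rw [hE]
      simp only [Finset.mul_sum, ← Finset.sum_sub_distrib]
      refine Finset.sum_congr rfl fun i _ => Finset.sum_congr rfl fun x _ =>
        Finset.sum_congr rfl fun z _ => ?_
      rw [hp', hval']
      ring
    rw [this, h₁]
    field_simp
  have hsecond : ∑ i, w i * ∑ x, ∑ z, p i x z * val i x z ^ 2 =
      (N + 1) ^ 2 * (∑ i, w i * ∑ x, ∑ z, r i x z * o i x z ^ 2) / N -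
        2 * (N + 1) * T * (∑ i, w i * ∑ x, ∑ z, r i x z * o i x z) / N + T ^ 2 := by
    have : ∑ i, w i * ∑ x, ∑ z, p i x z * val i x z ^ 2 =
        1 / N * ((N + 1) ^ 2 * (∑ i, w i * ∑ x, ∑ z, r i x z * o i x z ^ 2) -
          2 * (N + 1) * T * (∑ i, w i * ∑ x, ∑ z, r i x z * o i x z) +
          T ^ 2 * ∑ i, w i * ∑ x, ∑ z, r i x z) := by
      simp only [Finset.mul_sum, ← Finset.sum_sub_distrib, ← Finset.sum_add_distrib]
      refine Finset.sum_congr rfl fun i _ => Finset.sum_congr rfl fun x _ =>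
        Finset.sum_congr rfl fun z _ => ?_
      rw [hp', hval']
      ring
    rw [this, h₁]
    field_simp
  rw [hVar, hsecond, hfirst, hO₀]
  exact ShadowVariance.variance_arith hN hε hT ha hb
    (hc.trans hb) hD hcb h₃ h₂
end
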